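/- arXiv:2401.12124 — 6 statements merged into one kernel-verified Lean document; each statement's English description precedes it below -/
import Mathlib

section
/- Let n ≥ 3 and let t_1 > t_2 > ... > t_n > 0 be real numbers. If for every k with 3 ≤ k ≤ n one has t_k > (k-2) / (∑_{i=1}^{k-1} 1/t_i), then for every j with 1 ≤ j ≤ n one has t_j > (n-1) / (∑_{i=1}^{n} 1/t_i). -/
open Finset

/-- If `n ≥ 3` and `t 1 > t 2 > ... > t n > 0`, and for every `k` with
`3 ≤ k ≤ n` one has `t k > (k-2) / (∑_{i=1}^{k-1} 1 / t i)`, then for every `j` with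
`1 ≤ j ≤ n` one has `t j > (n-1) / (∑_{i=1}^{n} 1 / t i)`. -/
theorem stmt_0 (n : ℕ) (hn : 3 ≤ n) (t : ℕ → ℝ)
    (hpos : ∀ i, 1 ≤ i → i ≤ n → 0 < t i)
    (hdec : ∀ i j, 1 ≤ i → i < j → j ≤ n → t j < t i)
    (hineq : ∀ k, 3 ≤ k → k ≤ n →
      t k > ((k : ℝ) - 2) / ∑ i ∈ Finset.Icc 1 (k - 1), 1 / t i) :
    ∀ j, 1 ≤ j → j ≤ n →
      t j > ((n : ℝ) - 1) / ∑ i ∈ Finset.Icc 1 n, 1 / t i := by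
  obtain ⟨m, rfl⟩ : ∃ m, n = m + 1 := ⟨n - 1, by omega⟩
  intro j hj1 hj2
  have h := hineq (m + 1) hn le_rfl
  have hn0 : 0 < t (m + 1) := hpos (m + 1) (by omega) le_rfl
  have hle : t (m + 1) ≤ t j := by
    rcases Nat.lt_or_ge j (m + 1) with hlt | hge
    · exact (hdec j (m + 1) hj1 hlt le_rfl).le
    · have : j = m + 1 := by omega
      rw [this]
  have hS : 0 < ∑ i ∈ Finset.Icc 1 m, 1 / t i := by
    apply Finset.sum_pos
    · intro i hi
      rw [Finset.mem_Icc] at hi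
      exact one_div_pos.mpr (hpos i hi.1 (by omega))
    · exact ⟨1, Finset.mem_Icc.mpr ⟨le_rfl, by omega⟩⟩
  rw [Nat.add_sub_cancel, gt_iff_lt, div_lt_iff₀ hS] at h
  refine lt_of_lt_of_le ?_ hle
  rw [Finset.sum_Icc_succ_top (by omega)]
  have h1 : 0 < 1 / t (m + 1) := one_div_pos.mpr hn0
  rw [div_lt_iff₀ (by linarith), mul_add, mul_one_div_cancel hn0.ne']
  linarith
end

section
/- Let n ≥ 2 and let t_1 > t_2 > ... > t_n > 0 be real numbers with S = ∑_{k=1}^{n} 1/t_k, and suppose t_j > (n-1)/S for every j. Define η*_j = (t_j·S - (n-1)) / (t_j·S). Then for every pure strategy i of agent I, the payoff of agent I's pure strategy i against the mixed strategy Y* = (η*_1, ..., η*_n) in the game with payoff matrix H (where H_{ij} = 0 if i = j and H_{ij} = t_i if i ≠ j) equals (n-1)/S; that is, ∑_{j ≠ i} t_i · η*_j = (1 - η*_i)·t_i = (n-1)/S for every i = 1, ..., n. -/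
open Finset

/-- With `n ≥ 2`, `t 1 > ... > t n > 0`, `S = ∑_{k=1}^n 1/t k`,
`t j > (n-1)/S` for all `j`, and `η j = (t j * S - (n-1)) / (t j * S)`, the payoff of
pure strategy `i` of agent I against the mixed strategy `Y* = (η 1, ..., η n)` in the
game with matrix `H i j = if i = j then 0 else t i` equals `(n-1)/S`:
`∑_{j ≠ i} t i * η j = (1 - η i) * t i = (n-1)/S` for every `i = 1, ..., n`. -/
theorem stmt_2 (n : ℕ) (hn : 2 ≤ n) (t : ℕ → ℝ)
    (hpos : ∀ i, 1 ≤ i → i ≤ n → 0 < t i)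
    (hdec : ∀ i j, 1 ≤ i → i < j → j ≤ n → t j < t i)
    (S : ℝ) (hS : S = ∑ k ∈ Finset.Icc 1 n, 1 / t k)
    (hgt : ∀ j, 1 ≤ j → j ≤ n → t j > ((n : ℝ) - 1) / S)
    (η : ℕ → ℝ)
    (hη : ∀ j, 1 ≤ j → j ≤ n → η j = (t j * S - ((n : ℝ) - 1)) / (t j * S)) :
    ∀ i, 1 ≤ i → i ≤ n →
      (∑ j ∈ Finset.Icc 1 n, (if i = j then (0 : ℝ) else t i) * η j
          = ∑ j ∈ (Finset.Icc 1 n).erase i, t i * η j) ∧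
      (∑ j ∈ (Finset.Icc 1 n).erase i, t i * η j = (1 - η i) * t i) ∧
      ((1 - η i) * t i = ((n : ℝ) - 1) / S) := by
  intro i hi1 hin
  have hSpos : 0 < S := by
    rw [hS]
    apply Finset.sum_pos
    · intro k hk
      rw [Finset.mem_Icc] at hk
      exact one_div_pos.mpr (hpos k hk.1 hk.2)
    · exact ⟨1, Finset.mem_Icc.mpr ⟨le_refl 1, by omega⟩⟩
  have hmem : i ∈ Finset.Icc 1 n := Finset.mem_Icc.mpr ⟨hi1, hin⟩
  have hsum : ∑ j ∈ Finset.Icc 1 n, η j = 1 := by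
    have h1 : ∑ j ∈ Finset.Icc 1 n, η j
        = ∑ j ∈ Finset.Icc 1 n, (1 - (((n : ℝ) - 1) / S) * (1 / t j)) := by
      apply Finset.sum_congr rfl
      intro j hj
      rw [Finset.mem_Icc] at hj
      have := hpos j hj.1 hj.2
      rw [hη j hj.1 hj.2]
      field_simp
    rw [h1, Finset.sum_sub_distrib, ← Finset.mul_sum, ← hS, div_mul_cancel₀ _ hSpos.ne']
    simp
  have herase : ∑ j ∈ (Finset.Icc 1 n).erase i, η j = 1 - η i := by
    rw [← hsum, ← Finset.add_sum_erase _ η hmem]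
    ring
  refine ⟨?_, ?_, ?_⟩
  · rw [← Finset.add_sum_erase _ _ hmem]
    simp only [if_true, zero_mul, zero_add]
    apply Finset.sum_congr rfl
    intro j hj
    rw [if_neg (Finset.ne_of_mem_erase hj).symm]
  · rw [← Finset.mul_sum, herase, mul_comm]
  · have := hpos i hi1 hin
    rw [hη i hi1 hin]
    field_simp
    ring
end

section
/- Let n ≥ 2 and let t_1 > t_2 > ... > t_n > 0 be real numbers with S = ∑_{k=1}^{n} 1/t_k, and suppose t_j > (n-1)/S for every j. Define ξ*_i = (t_i·S)^{-1} and η*_j = (t_j·S - (n-1))/(t_j·S), and set X* = (ξ*_1,...,ξ*_n), Y* = (η*_1,...,η*_n). Then for every pair of mixed strategies x, y ∈ ℝ^n one has H(x, Y*) ≤ (n-1)/S ≤ H(X*, y), where H(x,y) = ∑_{i,j} x_i·H_{ij}·y_j and H_{ij} = 0 if i = j, H_{ij} = t_i otherwise. In particular (X*, Y*) is a saddle point in mixed strategies and the value of the game is v = (n-1)/S. -/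
open Finset

/-- With `n ≥ 2`, `t 1 > ... > t n > 0`, `S = ∑_{k=1}^n 1/t k`,
`t j > (n-1)/S` for all `j`, `ξ i = (t i * S)⁻¹` and
`η j = (t j * S - (n-1)) / (t j * S)`, for every pair of mixed strategies `x, y` one has
`H(x, Y*) ≤ (n-1)/S ≤ H(X*, y)` where `H i j = if i = j then 0 else t i`. Hence
`(X*, Y*)` is a saddle point in mixed strategies and the value of the game is
`v = (n-1)/S`. -/
theorem stmt_5 (n : ℕ) (hn : 2 ≤ n) (t : ℕ → ℝ)
    (hpos : ∀ i, 1 ≤ i → i ≤ n → 0 < t i)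
    (hdec : ∀ i j, 1 ≤ i → i < j → j ≤ n → t j < t i)
    (S : ℝ) (hS : S = ∑ k ∈ Finset.Icc 1 n, 1 / t k)
    (hgt : ∀ j, 1 ≤ j → j ≤ n → t j > ((n : ℝ) - 1) / S)
    (ξ η : ℕ → ℝ)
    (hξ : ∀ i, 1 ≤ i → i ≤ n → ξ i = (t i * S)⁻¹)
    (hη : ∀ j, 1 ≤ j → j ≤ n → η j = (t j * S - ((n : ℝ) - 1)) / (t j * S)) :
    ∀ x y : ℕ → ℝ,
      (∀ i, 1 ≤ i → i ≤ n → 0 ≤ x i) → (∑ i ∈ Finset.Icc 1 n, x i = 1) →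
      (∀ j, 1 ≤ j → j ≤ n → 0 ≤ y j) → (∑ j ∈ Finset.Icc 1 n, y j = 1) →
      (∑ i ∈ Finset.Icc 1 n, ∑ j ∈ Finset.Icc 1 n,
          x i * (if i = j then (0 : ℝ) else t i) * η j ≤ ((n : ℝ) - 1) / S) ∧
      (((n : ℝ) - 1) / S ≤ ∑ i ∈ Finset.Icc 1 n, ∑ j ∈ Finset.Icc 1 n,
          ξ i * (if i = j then (0 : ℝ) else t i) * y j) := by
  intro x y hx hx1 hy hy1
  have hSpos : 0 < S := by
    rw [hS]
    apply Finset.sum_pos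
    · intro i hi
      rw [Finset.mem_Icc] at hi
      exact one_div_pos.mpr (hpos i hi.1 hi.2)
    · exact ⟨1, Finset.mem_Icc.mpr ⟨le_refl _, by omega⟩⟩
  have key : ∀ (c : ℝ) (b : ℕ → ℝ), ∑ j ∈ Finset.Icc 1 n, b j = 1 →
      ∀ i ∈ Finset.Icc 1 n,
      ∑ j ∈ Finset.Icc 1 n, c * (if i = j then (0 : ℝ) else t i) * b j
        = c * t i * (1 - b i) := by
    intro c b hb i hi
    have h : ∀ j ∈ Finset.Icc 1 n, c * (if i = j then (0 : ℝ) else t i) * b j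
        = c * t i * b j - (if i = j then c * t i * b j else 0) := by
      intro j _
      split_ifs <;> ring
    rw [Finset.sum_congr rfl h, Finset.sum_sub_distrib, Finset.sum_ite_eq, if_pos hi,
      ← Finset.mul_sum, hb]
    ring
  have hη1 : ∑ j ∈ Finset.Icc 1 n, η j = 1 := by
    have h : ∀ j ∈ Finset.Icc 1 n, η j = 1 - ((n : ℝ) - 1) / S * (1 / t j) := by
      intro j hj
      rw [Finset.mem_Icc] at hj
      have := hpos j hj.1 hj.2
      rw [hη j hj.1 hj.2]
      field_simp
    rw [Finset.sum_congr rfl h, Finset.sum_sub_distrib, ← Finset.mul_sum, ← hS]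
    simp only [Finset.sum_const, Nat.card_Icc, nsmul_eq_mul]
    have := hSpos.ne'
    field_simp
    simp
  constructor
  · apply le_of_eq
    rw [Finset.sum_congr rfl (fun i hi => key (x i) η hη1 i hi)]
    have h : ∀ i ∈ Finset.Icc 1 n, x i * t i * (1 - η i) = x i * (((n : ℝ) - 1) / S) := by
      intro j hj
      rw [Finset.mem_Icc] at hj
      have := hpos j hj.1 hj.2
      rw [hη j hj.1 hj.2]
      field_simp
      ring
    rw [Finset.sum_congr rfl h, ← Finset.sum_mul, hx1, one_mul]
  · apply le_of_eq
    rw [Finset.sum_congr rfl (fun i hi => key (ξ i) y hy1 i hi)]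
    have h : ∀ i ∈ Finset.Icc 1 n, ξ i * t i * (1 - y i) = 1 / S * (1 - y i) := by
      intro j hj
      rw [Finset.mem_Icc] at hj
      have := hpos j hj.1 hj.2
      rw [hξ j hj.1 hj.2]
      field_simp
    rw [Finset.sum_congr rfl h, ← Finset.mul_sum, Finset.sum_sub_distrib, hy1]
    simp only [Finset.sum_const, Nat.card_Icc, nsmul_eq_mul]
    simp
    ring
end

section
/- Let n ≥ 3, let t_1 > t_2 > ... > t_n > 0 be real numbers, and let ω with 2 ≤ ω < n satisfy: t_k > (k-2)/(∑_{i=1}^{k-1} 1/t_i) for all 3 ≤ k ≤ ω. Write S_ω = ∑_{k=1}^{ω} 1/t_k and define η*_j = (t_j·S_ω - (ω-1))/(t_j·S_ω) for 1 ≤ j ≤ ω and η*_j = 0 for ω < j ≤ n. Then η*_j ≥ 0 for all j and ∑_{j=1}^{n} η*_j = 1; that is, Y* = (η*_1, ..., η*_ω, 0, ..., 0) is a mixed strategy. -/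
open Finset

/-- With `n ≥ 3`, `t 1 > ... > t n > 0`, `2 ≤ ω < n` satisfying
`t k > (k-2)/(∑_{i=1}^{k-1} 1/t i)` for all `3 ≤ k ≤ ω`, `S_ω = ∑_{k=1}^{ω} 1/t k`,
and `η j = (t j * S_ω - (ω-1))/(t j * S_ω)` for `1 ≤ j ≤ ω`, `η j = 0` for
`ω < j ≤ n`, the vector `Y* = (η 1, ..., η ω, 0, ..., 0)` has nonnegative
components summing to one, i.e. it is a mixed strategy. -/
theorem stmt_8 (n : ℕ) (hn : 3 ≤ n) (t : ℕ → ℝ)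
    (hpos : ∀ i, 1 ≤ i → i ≤ n → 0 < t i)
    (hdec : ∀ i j, 1 ≤ i → i < j → j ≤ n → t j < t i)
    (ω : ℕ) (hω2 : 2 ≤ ω) (hωn : ω < n)
    (h17 : ∀ k, 3 ≤ k → k ≤ ω →
      t k > ((k : ℝ) - 2) / ∑ i ∈ Finset.Icc 1 (k - 1), 1 / t i)
    (Sω : ℝ) (hSω : Sω = ∑ k ∈ Finset.Icc 1 ω, 1 / t k)
    (η : ℕ → ℝ)
    (hη : ∀ j, 1 ≤ j → j ≤ n →
      η j = if j ≤ ω then (t j * Sω - ((ω : ℝ) - 1)) / (t j * Sω) else 0) :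
    (∀ j, 1 ≤ j → j ≤ n → 0 ≤ η j) ∧ ∑ j ∈ Finset.Icc 1 n, η j = 1 := by
  have hSpos : ∀ m, 1 ≤ m → m ≤ n → 0 < ∑ k ∈ Finset.Icc 1 m, 1 / t k := by
    intro m h1 hm
    apply Finset.sum_pos
    · intro i hi
      rw [Finset.mem_Icc] at hi
      exact one_div_pos.mpr (hpos i hi.1 (by omega))
    · exact ⟨1, Finset.mem_Icc.mpr ⟨le_refl _, h1⟩⟩
  have hS : 0 < Sω := hSω ▸ hSpos ω (by omega) (by omega)
  have hkey : (ω : ℝ) - 1 ≤ t ω * Sω := by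
    obtain ⟨m, rfl⟩ : ∃ m, ω = m + 1 := ⟨ω - 1, by omega⟩
    have hp := hSpos m (by omega) (by omega)
    have ht := hpos (m + 1) (by omega) (by omega)
    rw [hSω, Finset.sum_Icc_succ_top (by omega), mul_add, mul_one_div_cancel ht.ne']
    have h2 : (m : ℝ) - 1 ≤ t (m + 1) * ∑ k ∈ Finset.Icc 1 m, 1 / t k := by
      rcases Nat.lt_or_ge m 2 with h | h
      · have : m = 1 := by omega
        have h3 := mul_pos ht hp
        have h4 : (m : ℝ) = 1 := by exact_mod_cast this
        linarith
      · have h3 := h17 (m + 1) (by omega) le_rfl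
        rw [Nat.add_sub_cancel, gt_iff_lt, div_lt_iff₀ hp] at h3
        push_cast at h3
        linarith
    push_cast
    linarith
  refine ⟨?_, ?_⟩
  · intro j h1 hj
    rw [hη j h1 hj]
    split_ifs with h
    · have hle : t ω ≤ t j := by
        rcases h.lt_or_eq with h | h
        · exact (hdec j ω h1 h hωn.le).le
        · rw [h]
      have := mul_le_mul_of_nonneg_right hle hS.le
      exact div_nonneg (by linarith) (mul_pos (hpos j h1 hj) hS).le
    · exact le_rfl
  · have hsub : Finset.Icc 1 ω ⊆ Finset.Icc 1 n := Finset.Icc_subset_Icc le_rfl hωn.le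
    rw [← Finset.sum_subset hsub]
    · have : ∀ j ∈ Finset.Icc 1 ω, η j = 1 - ((ω : ℝ) - 1) / Sω * (1 / t j) := by
        intro j hj
        rw [Finset.mem_Icc] at hj
        have ht := hpos j hj.1 (by omega)
        rw [hη j hj.1 (by omega), if_pos hj.2]
        field_simp
      rw [Finset.sum_congr rfl this, Finset.sum_sub_distrib, ← Finset.mul_sum, ← hSω,
        div_mul_cancel₀ _ hS.ne']
      simp
    · intro j hj hj'
      rw [Finset.mem_Icc] at hj hj'
      rw [hη j hj.1 hj.2, if_neg (by omega)]
end

section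
/- Let n ≥ 3, let t_1 > t_2 > ... > t_n > 0 be real numbers, let 2 ≤ ω < n, write S_ω = ∑_{k=1}^{ω} 1/t_k, and define η*_j = (t_j·S_ω - (ω-1))/(t_j·S_ω) for 1 ≤ j ≤ ω and η*_j = 0 for ω < j ≤ n. Then in the game with payoff matrix H (H_{ij} = 0 if i = j, H_{ij} = t_i otherwise), for every pure strategy i with 1 ≤ i ≤ ω one has H(i, Y*) = ∑_{j ≠ i} t_i·η*_j = (1 - η*_i)·t_i = (ω-1)/S_ω. -/
open Finset

/-- With `n ≥ 3`, `t 1 > ... > t n > 0`, `2 ≤ ω < n`,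
`S_ω = ∑_{k=1}^{ω} 1/t k`, and `η j = (t j * S_ω - (ω-1))/(t j * S_ω)` for
`1 ≤ j ≤ ω`, `η j = 0` for `ω < j ≤ n`, in the game with matrix
`H i j = if i = j then 0 else t i`, for every pure strategy `i` with `1 ≤ i ≤ ω` one
has `H(i, Y*) = ∑_{j ≠ i} t i * η j = (1 - η i) * t i = (ω-1)/S_ω`. -/
theorem stmt_9 (n : ℕ) (hn : 3 ≤ n) (t : ℕ → ℝ)
    (hpos : ∀ i, 1 ≤ i → i ≤ n → 0 < t i)
    (hdec : ∀ i j, 1 ≤ i → i < j → j ≤ n → t j < t i)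
    (ω : ℕ) (hω2 : 2 ≤ ω) (hωn : ω < n)
    (Sω : ℝ) (hSω : Sω = ∑ k ∈ Finset.Icc 1 ω, 1 / t k)
    (η : ℕ → ℝ)
    (hη : ∀ j, 1 ≤ j → j ≤ n →
      η j = if j ≤ ω then (t j * Sω - ((ω : ℝ) - 1)) / (t j * Sω) else 0) :
    ∀ i, 1 ≤ i → i ≤ ω →
      (∑ j ∈ Finset.Icc 1 n, (if i = j then (0 : ℝ) else t i) * η j
          = ∑ j ∈ (Finset.Icc 1 n).erase i, t i * η j) ∧
      (∑ j ∈ (Finset.Icc 1 n).erase i, t i * η j = (1 - η i) * t i) ∧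
      ((1 - η i) * t i = ((ω : ℝ) - 1) / Sω) := by
  have hS : 0 < Sω := by
    rw [hSω]
    apply Finset.sum_pos
    · intro k hk
      rw [Finset.mem_Icc] at hk
      exact one_div_pos.mpr (hpos k hk.1 (by omega))
    · exact ⟨1, by rw [Finset.mem_Icc]; omega⟩
  have hsum : ∑ j ∈ Finset.Icc 1 n, η j = 1 := by
    have h1 : ∑ j ∈ Finset.Icc 1 ω, η j = ∑ j ∈ Finset.Icc 1 n, η j := by
      apply Finset.sum_subset
      · exact Finset.Icc_subset_Icc_right hωn.le
      · intro j hj hj'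
        rw [Finset.mem_Icc] at hj hj'
        rw [hη j hj.1 hj.2, if_neg (by omega)]
    have h2 : ∑ j ∈ Finset.Icc 1 ω, η j
        = ∑ j ∈ Finset.Icc 1 ω, (1 - ((ω : ℝ) - 1) / Sω * (1 / t j)) := by
      apply Finset.sum_congr rfl
      intro j hj
      rw [Finset.mem_Icc] at hj
      have ht := hpos j hj.1 (by omega)
      rw [hη j hj.1 (by omega), if_pos hj.2]
      field_simp
    rw [← h1, h2, Finset.sum_sub_distrib, ← Finset.mul_sum, ← hSω, div_mul_cancel₀ _ hS.ne']
    simp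
  intro i hi1 hi2
  have hmem : i ∈ Finset.Icc 1 n := by rw [Finset.mem_Icc]; omega
  refine ⟨?_, ?_, ?_⟩
  · rw [← Finset.add_sum_erase _ _ hmem, if_pos rfl, zero_mul, zero_add]
    apply Finset.sum_congr rfl
    intro j hj
    rw [if_neg (Finset.ne_of_mem_erase hj).symm]
  · rw [← Finset.mul_sum, ← hsum, ← Finset.add_sum_erase _ _ hmem]
    ring
  · have ht := hpos i hi1 (by omega)
    rw [hη i hi1 (by omega), if_pos hi2]
    field_simp
    ring
end

section
/- Let n ≥ 3, let t_1 > t_2 > ... > t_n > 0 be real numbers, and let 2 ≤ ω < n be such that t_k > (k-2)/(∑_{i=1}^{k-1} 1/t_i) for all 3 ≤ k ≤ ω and t_{ω+1} ≤ (ω-1)/(∑_{i=1}^{ω} 1/t_i). Write S_ω = ∑_{k=1}^{ω} 1/t_k and define X* by ξ*_i = (t_i·S_ω)^{-1} for i ≤ ω, ξ*_i = 0 for i > ω, and Y* by η*_j = (t_j·S_ω - (ω-1))/(t_j·S_ω) for j ≤ ω, η*_j = 0 for j > ω. Then in the game with payoff matrix H (H_{ij} = 0 if i = j, H_{ij} =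 t_i otherwise), for all mixed strategies x, y ∈ ℝ^n one has H(x, Y*) ≤ (ω-1)/S_ω ≤ H(X*, y). In particular (X*, Y*) is a saddle point in mixed strategies and the value of the game is v = (ω-1)/S_ω. -/
open Finset

lemma aux_row (s : Finset ℕ) (i : ℕ) (hi : i ∈ s) (a c : ℝ) (f : ℕ → ℝ) :
    ∑ j ∈ s, c * (if i = j then (0 : ℝ) else a) * f j = c * (a * (∑ j ∈ s, f j - f i)) := by
  have h : ∀ j ∈ s, c * (if i = j then (0 : ℝ) else a) * f j
      = c * a * f j - (if i = j then c * a * f j else 0) := by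
    intro j _
    split_ifs <;> ring
  rw [Finset.sum_congr rfl h, Finset.sum_sub_distrib, Finset.sum_ite_eq, if_pos hi,
    ← Finset.mul_sum]
  ring

lemma aux_trunc (n ω : ℕ) (h : ω < n) (f g : ℕ → ℝ)
    (hf : ∀ i, 1 ≤ i → i ≤ n → f i = if i ≤ ω then g i else 0) :
    ∑ i ∈ Finset.Icc 1 n, f i = ∑ i ∈ Finset.Icc 1 ω, g i := by
  symm
  have h1 : ∑ i ∈ Finset.Icc 1 ω, g i = ∑ i ∈ Finset.Icc 1 ω, f i := by
    refine Finset.sum_congr rfl fun i hi => ?_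
    rw [Finset.mem_Icc] at hi
    rw [hf i hi.1 (by omega), if_pos hi.2]
  rw [h1]
  refine Finset.sum_subset (Finset.Icc_subset_Icc le_rfl h.le) fun i hi hi2 => ?_
  rw [Finset.mem_Icc] at hi hi2
  rw [hf i hi.1 hi.2, if_neg (by omega)]

/-- With `n ≥ 3`, `t 1 > ... > t n > 0`, and `2 ≤ ω < n` such that
`t k > (k-2)/(∑_{i=1}^{k-1} 1/t i)` for all `3 ≤ k ≤ ω` and
`t (ω+1) ≤ (ω-1)/(∑_{i=1}^{ω} 1/t i)`; with `S_ω = ∑_{k=1}^{ω} 1/t k`,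
`ξ i = (t i * S_ω)⁻¹` for `i ≤ ω`, `ξ i = 0` for `i > ω`, and
`η j = (t j * S_ω - (ω-1))/(t j * S_ω)` for `j ≤ ω`, `η j = 0` for `j > ω`:
in the game with matrix `H i j = if i = j then 0 else t i` one has
`H(x, Y*) ≤ (ω-1)/S_ω ≤ H(X*, y)` for all mixed strategies `x, y`. In particular
`(X*, Y*)` is a saddle point and the value of the game is `v = (ω-1)/S_ω`. -/
theorem stmt_14 (n : ℕ) (hn : 3 ≤ n) (t : ℕ → ℝ)
    (hpos : ∀ i, 1 ≤ i → i ≤ n → 0 < t i)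
    (hdec : ∀ i j, 1 ≤ i → i < j → j ≤ n → t j < t i)
    (ω : ℕ) (hω2 : 2 ≤ ω) (hωn : ω < n)
    (h17 : ∀ k, 3 ≤ k → k ≤ ω →
      t k > ((k : ℝ) - 2) / ∑ i ∈ Finset.Icc 1 (k - 1), 1 / t i)
    (Sω : ℝ) (hSω : Sω = ∑ k ∈ Finset.Icc 1 ω, 1 / t k)
    (h18 : t (ω + 1) ≤ ((ω : ℝ) - 1) / Sω)
    (ξ η : ℕ → ℝ)
    (hξ : ∀ i, 1 ≤ i → i ≤ n →
      ξ i = if i ≤ ω then (t i * Sω)⁻¹ else 0)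
    (hη : ∀ j, 1 ≤ j → j ≤ n →
      η j = if j ≤ ω then (t j * Sω - ((ω : ℝ) - 1)) / (t j * Sω) else 0) :
    ∀ x y : ℕ → ℝ,
      (∀ i, 1 ≤ i → i ≤ n → 0 ≤ x i) → (∑ i ∈ Finset.Icc 1 n, x i = 1) →
      (∀ j, 1 ≤ j → j ≤ n → 0 ≤ y j) → (∑ j ∈ Finset.Icc 1 n, y j = 1) →
      (∑ i ∈ Finset.Icc 1 n, ∑ j ∈ Finset.Icc 1 n,
          x i * (if i = j then (0 : ℝ) else t i) * η j ≤ ((ω : ℝ) - 1) / Sω) ∧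
      (((ω : ℝ) - 1) / Sω ≤ ∑ i ∈ Finset.Icc 1 n, ∑ j ∈ Finset.Icc 1 n,
          ξ i * (if i = j then (0 : ℝ) else t i) * y j) := by
  intro x y hx hx1 hy hy1
  have hS : 0 < Sω := by
    rw [hSω]
    refine Finset.sum_pos (fun i hi => ?_) ⟨1, by simp; omega⟩
    rw [Finset.mem_Icc] at hi
    exact one_div_pos.mpr (hpos i hi.1 (by omega))
  constructor
  · have hsum : ∑ j ∈ Finset.Icc 1 n, η j = 1 := by
      rw [aux_trunc n ω hωn η _ hη]
      have h : ∀ j ∈ Finset.Icc 1 ω, (t j * Sω - ((ω : ℝ) - 1)) / (t j * Sω)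
          = 1 - ((ω : ℝ) - 1) / Sω * (1 / t j) := by
        intro j hj
        rw [Finset.mem_Icc] at hj
        have := (hpos j hj.1 (by omega)).ne'
        have := hS.ne'
        field_simp
      rw [Finset.sum_congr rfl h, Finset.sum_sub_distrib, ← Finset.mul_sum, ← hSω,
        div_mul_cancel₀ _ hS.ne']
      simp
    calc _ = ∑ i ∈ Finset.Icc 1 n, x i * (t i * (1 - η i)) := by
          refine Finset.sum_congr rfl fun i hi => ?_
          rw [aux_row _ i hi, hsum]
      _ ≤ ∑ i ∈ Finset.Icc 1 n, x i * (((ω : ℝ) - 1) / Sω) := by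
          refine Finset.sum_le_sum fun i hi => ?_
          rw [Finset.mem_Icc] at hi
          refine mul_le_mul_of_nonneg_left ?_ (hx i hi.1 hi.2)
          rw [hη i hi.1 hi.2]
          split_ifs with hc
          · have := (hpos i hi.1 hi.2).ne'
            have := hS.ne'
            apply le_of_eq
            field_simp
            ring
          · rw [sub_zero, mul_one]
            refine le_trans ?_ h18
            rcases Nat.eq_or_lt_of_le (show ω + 1 ≤ i by omega) with h | h
            · rw [h]
            · exact (hdec _ _ (by omega) h hi.2).le
      _ = _ := by rw [← Finset.sum_mul, hx1, one_mul]
  · have hξt : ∀ i, 1 ≤ i → i ≤ n → ξ i * t i = if i ≤ ω then 1 / Sω else 0 := by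
      intro i h1 h2
      rw [hξ i h1 h2]
      have := (hpos i h1 h2).ne'
      have := hS.ne'
      split_ifs
      · field_simp
      · simp
    have hsum : ∑ i ∈ Finset.Icc 1 n, ξ i * t i = ω / Sω := by
      rw [aux_trunc n ω hωn (fun i => ξ i * t i) _ hξt]
      simp [div_eq_mul_inv]
    rw [Finset.sum_comm]
    calc ((ω : ℝ) - 1) / Sω = ∑ j ∈ Finset.Icc 1 n, y j * (((ω : ℝ) - 1) / Sω) := by
          rw [← Finset.sum_mul, hy1, one_mul]
      _ ≤ ∑ j ∈ Finset.Icc 1 n, y j * (1 * (∑ i ∈ Finset.Icc 1 n, ξ i * t i - ξ j * t j)) := by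
          refine Finset.sum_le_sum fun j hj => ?_
          rw [Finset.mem_Icc] at hj
          refine mul_le_mul_of_nonneg_left ?_ (hy j hj.1 hj.2)
          rw [hsum, hξt j hj.1 hj.2, one_mul, sub_div]
          have := one_div_pos.mpr hS
          split_ifs <;> linarith
      _ = _ := by
          refine Finset.sum_congr rfl fun j hj => ?_
          rw [← aux_row _ j hj 1 (y j) (fun i => ξ i * t i)]
          refine Finset.sum_congr rfl fun i _ => ?_
          by_cases h : i = j
          · simp [h]
          · rw [if_neg h, if_neg (Ne.symm h)]
            ring
end
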